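/- There are no prime p with p ≡ 3 (mod 4) and integers ℓ ≥ 2, α ≥ 2 such that the number n = 2^{ℓ−2}·(3p−1)·p^{α−1} satisfies n + φ(n) = 2^ℓ·p^α. -/

import Mathlib

theorem totient_two_pow_mul_of_even {q : ℕ} (hq : 2 ∣ q) (a : ℕ) :
    Nat.totient (2 ^ a * q) = 2 ^ a * Nat.totient q := by
  induction a with
  | zero => simp
  | succ a ih =>
    rw [pow_succ', mul_assoc, Nat.totient_mul_of_prime_of_dvd Nat.prime_two (hq.mul_left _), ih,
      mul_assoc]

theorem stmt_12 :
    ¬ ∃ (p ℓ α : ℕ), Nat.Prime p ∧ p % 4 = 3 ∧ 2 ≤ ℓ ∧ 2 ≤ α ∧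
      2 ^ (ℓ - 2) * (3 * p - 1) * p ^ (α - 1) +
        Nat.totient (2 ^ (ℓ - 2) * (3 * p - 1) * p ^ (α - 1)) = 2 ^ ℓ * p ^ α := by
  rintro ⟨p, ℓ, α, hp, hmod, hℓ, hα, h⟩
  obtain ⟨a, rfl⟩ := Nat.exists_eq_add_of_le' hℓ
  obtain ⟨b, rfl⟩ := Nat.exists_eq_add_of_le' hα
  obtain ⟨r, rfl⟩ : ∃ r, p = r + 1 := ⟨p - 1, by omega⟩
  have hq : 3 * (r + 1) - 1 = 3 * r + 2 := by omega
  have heven : 2 ∣ 3 * r + 2 := by omega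
  have hcop : Nat.Coprime (2 ^ a * (3 * r + 2)) ((r + 1) ^ (b + 1)) := by
    refine Nat.Coprime.pow_right _ (Nat.Coprime.mul_left (Nat.Coprime.pow_left _ ?_) ?_)
    · exact (Nat.coprime_primes Nat.prime_two hp).2 (by omega)
    · refine ((Nat.Prime.coprime_iff_not_dvd hp).2 fun hd => ?_).symm
      have : r + 1 ∣ 1 := by
        rw [← Nat.dvd_add_right hd, show 3 * r + 2 + 1 = 3 * (r + 1) by ring]
        exact dvd_mul_left _ _
      exact hp.one_lt.ne' (Nat.dvd_one.1 this)
  rw [Nat.add_sub_cancel, show b + 2 - 1 = b + 1 by omega, hq, Nat.totient_mul hcop,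
    totient_two_pow_mul_of_even heven, Nat.totient_prime_pow_succ hp, Nat.add_sub_cancel] at h
  have hpos : 0 < 2 ^ a * (r + 1) ^ b := by positivity
  have hkey : (3 * r + 2) * (r + 1) + Nat.totient (3 * r + 2) * r = 4 * (r + 1) ^ 2 :=
    Nat.eq_of_mul_eq_mul_left hpos (by linear_combination h)
  have hdvd : r ∣ 2 := by
    have h1 : r ∣ r * (Nat.totient (3 * r + 2) + 3 * r + 5) := dvd_mul_right _ _
    rw [show r * (Nat.totient (3 * r + 2) + 3 * r + 5) = r * (4 * r + 8) + 2 by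
      linear_combination hkey] at h1
    exact (Nat.dvd_add_right (dvd_mul_right _ _)).1 h1
  have hr : r = 2 := by
    have := Nat.le_of_dvd two_pos hdvd
    omega
  subst hr
  have h8 : Nat.totient (3 * 2 + 2) = 4 := by decide
  omega
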